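/- arXiv:2108.00987 — 2 statements merged into one kernel-verified Lean document; each statement's English description precedes it below -/
import Mathlib

section
/- Let S and T be two disjoint vertex sets in a graph F such that any two distinct vertices in S have at least s common neighbors in T. If there is an edge of F with both endpoints in S, then for any odd integer l with 3 ≤ l ≤ min(2s+1, 2|S|−1), the number of cycles of length l in F is at least (s − l/2 + 3/2)^{(l−1)/2} · (|S| − (l−1)/2)^{(l−3)/2}. -/
open Finset
open scoped Classical

noncomputable section

/-- The number of cycles with `l` vertices in `G`, counted as subgraphs. -/
def cycleCount {V : Type*} (G : SimpleGraph V) (l : ℕ) : ℕ :=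
  Nat.card {f : ZMod l → V // Function.Injective f ∧ ∀ i, G.Adj (f i) (f (i + 1))} / (2 * l)

/-- Greedy count of systems of distinct representatives. -/
theorem exists_distinct_representatives {V : Type*} (k : ℕ) :
    ∀ (s : ℕ) (N : Fin k → Finset V), (∀ i, s ≤ (N i).card) →
      ∃ A : Finset (Fin k → V),
        (∀ t ∈ A, Function.Injective t ∧ ∀ i, t i ∈ N i) ∧ (s + 1 - k) ^ k ≤ A.card := by
  induction k with
  | zero =>
    intro s N _
    exact ⟨{Fin.elim0}, fun t _ => ⟨fun i => i.elim0, fun i => i.elim0⟩, by simp⟩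
  | succ k ih =>
    intro s N hN
    have hrest (a : V) (i : Fin k) : s - 1 ≤ ((N i.succ).erase a).card :=
      (Nat.sub_le_sub_right (hN i.succ) 1).trans Finset.pred_card_le_card_erase
    choose A hA hcard using fun a => ih (s - 1) (fun i => (N i.succ).erase a) (hrest a)
    refine ⟨((N 0).sigma A).image fun q => Fin.cons (α := fun _ => V) q.1 q.2, ?_, ?_⟩
    · intro t ht
      obtain ⟨⟨a, t'⟩, hq, rfl⟩ := Finset.mem_image.mp ht
      obtain ⟨ha, ht'⟩ := Finset.mem_sigma.mp hq
      obtain ⟨hinj, hmem⟩ := hA a t' ht'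
      refine ⟨Fin.cons_injective_iff.mpr ⟨?_, hinj⟩, ?_⟩
      · rintro ⟨i, hi⟩
        exact (Finset.mem_erase.mp (hmem i)).1 hi
      · intro i
        refine Fin.cases ha (fun j => ?_) i
        exact (Finset.mem_erase.mp (hmem j)).2
    · rw [Finset.card_image_of_injective, Finset.card_sigma]
      · rcases Nat.eq_zero_or_pos s with rfl | hs
        · simp
        · calc (s + 1 - (k + 1)) ^ (k + 1)
              = (s + 1 - (k + 1)) * (s - 1 + 1 - k) ^ k := by
                rw [pow_succ', Nat.sub_add_cancel hs, Nat.add_sub_add_right]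
            _ ≤ (N 0).card * (s - 1 + 1 - k) ^ k :=
                Nat.mul_le_mul_right _ (by have := hN 0; omega)
            _ = ∑ _a ∈ N 0, (s - 1 + 1 - k) ^ k := by simp
            _ ≤ ∑ a ∈ N 0, (A a).card := Finset.sum_le_sum fun a _ => hcard a
      · rintro ⟨a, t⟩ ⟨b, t'⟩ h
        obtain ⟨rfl, rfl⟩ := Fin.cons_inj.mp h
        rfl

/-- Each cycle through a fixed edge, traversed from that edge in a fixed direction, accounts for
`2 * l` labelled cycles. -/
theorem card_le_cycleCount {V : Type*} [Fintype V] (G : SimpleGraph V) {l : ℕ} (hl : 3 ≤ l)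
    (u v : V) (A : Finset (ZMod l → V))
    (hA : ∀ p ∈ A, Function.Injective p ∧ (∀ i, G.Adj (p i) (p (i + 1))) ∧ p 0 = v ∧ p (-1) = u) :
    A.card ≤ cycleCount G l := by
  have : NeZero l := ⟨by omega⟩
  have htwo : (2 : ZMod l) ≠ 0 := fun h => by
    have h2 : ((2 : ℕ) : ZMod l) = 0 := by exact_mod_cast h
    have := Nat.le_of_dvd two_pos ((ZMod.natCast_eq_zero_iff 2 l).mp h2)
    omega
  rw [cycleCount, Nat.le_div_iff_mul_le (by omega)]
  have hcard : Nat.card (A × Bool × ZMod l) = A.card * (2 * l) := by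
    simp [Nat.card_eq_fintype_card, ZMod.card]
  rw [← hcard]
  let φ (b : Bool) (r i : ZMod l) : ZMod l := if b then i + r else r - i
  have hφ (b r) : Function.Injective (φ b r) := by
    intro i j h
    cases b <;> simpa [φ] using h
  refine Nat.card_le_card_of_injective
    (fun q : A × Bool × ZMod l => ⟨fun i => q.1.1 (φ q.2.1 q.2.2 i), ?_, ?_⟩) ?_
  · exact (hA _ q.1.2).1.comp (hφ _ _)
  · obtain ⟨⟨p, hp⟩, b, r⟩ := q
    intro i
    have hadj := (hA p hp).2.1
    cases b
    · have := (hadj (r - (i + 1))).symm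
      rw [show r - (i + 1) + 1 = r - i by ring] at this
      simpa [φ] using this
    · have := hadj (i + r)
      rw [show i + r + 1 = i + 1 + r by ring] at this
      simpa [φ] using this
  · rintro ⟨⟨p, hp⟩, b, r⟩ ⟨⟨p', hp'⟩, b', r'⟩ h
    have heq : ∀ i, p (φ b r i) = p' (φ b' r' i) := fun i => congrFun (congrArg Subtype.val h) i
    obtain ⟨-, -, hv, hu⟩ := hA p hp
    obtain ⟨hinj, -, hv', hu'⟩ := hA p' hp'
    have hzero (i) (hi : φ b r i = 0) : φ b' r' i = 0 :=
      hinj (by rw [← heq, hi, hv, hv'])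
    have hneg (i) (hi : φ b r i = -1) : φ b' r' i = -1 :=
      hinj (by rw [← heq, hi, hu, hu'])
    have hbr : b = b' ∧ r = r' := by
      cases b <;> cases b' <;> simp only [φ, if_true, if_false, Bool.false_eq_true] at hzero hneg
      · exact ⟨rfl, by linear_combination -hzero r (by ring)⟩
      · exact absurd (by linear_combination hneg (r + 1) (by ring) - hzero r (by ring)) htwo
      · exact absurd
          (by linear_combination hneg (-1 - r) (by ring) - hzero (-r) (by ring)) htwo
      · exact ⟨rfl, by linear_combination -hzero (-r) (by ring)⟩
    obtain ⟨rfl, rfl⟩ := hbr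
    have hpp : p = p' := by
      funext j
      have := heq (if b then j - r else r - j)
      cases b <;> simpa [φ] using this
    subst hpp
    rfl

/-- The sequence `v, x 0, …, x (m - 1), u, u, …`. -/
def pathVertex {V : Type*} (u v : V) {m : ℕ} (x : Fin m → V) (j : ℕ) : V :=
  if j = 0 then v else if h : j - 1 < m then x ⟨j - 1, h⟩ else u

theorem pathVertex_injOn {V : Type*} {u v : V} (huv : u ≠ v) {m : ℕ} {x : Fin m → V}
    (hx : Function.Injective x) (hu : ∀ i, x i ≠ u) (hv : ∀ i, x i ≠ v) {i j : ℕ}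
    (hi : i ≤ m + 1) (hj : j ≤ m + 1) (h : pathVertex u v x i = pathVertex u v x j) : i = j := by
  unfold pathVertex at h
  split_ifs at h with h1 h2 h3 h4 h5 h6 h7 h8
  all_goals first
    | omega
    | exact absurd h (hv _)
    | exact absurd h.symm (hv _)
    | exact absurd h (hu _)
    | exact absurd h.symm (hu _)
    | exact absurd h huv
    | exact absurd h.symm huv
    | (have := congrArg Fin.val (hx h)
       simp only at this
       omega)

theorem pathVertex_mem {V : Type*} {u v : V} {S : Finset V} (hu : u ∈ S) (hv : v ∈ S) {m : ℕ}
    {x : Fin m → V} (hx : ∀ i, x i ∈ S) (j : ℕ) : pathVertex u v x j ∈ S := by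
  unfold pathVertex
  split_ifs
  exacts [hv, hx _, hu]

/-- Interleaving of `pathVertex u v x` with `t`, as a closed sequence of odd length. -/
def interleave {V : Type*} (u v : V) {m : ℕ} (x : Fin m → V) (t : Fin (m + 1) → V)
    (i : ZMod (2 * m + 3)) : V :=
  if h : i.val % 2 = 1 then t ⟨i.val / 2, by have := ZMod.val_lt i; omega⟩
  else pathVertex u v x (i.val / 2)

theorem interleave_even {V : Type*} (u v : V) {m : ℕ} (x : Fin m → V) (t : Fin (m + 1) → V)
    {i : ZMod (2 * m + 3)} {j : ℕ} (h : i.val = 2 * j) :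
    interleave u v x t i = pathVertex u v x j := by
  rw [interleave, dif_neg (by omega), show i.val / 2 = j by omega]

theorem interleave_odd {V : Type*} (u v : V) {m : ℕ} (x : Fin m → V) (t : Fin (m + 1) → V)
    {i : ZMod (2 * m + 3)} {j : Fin (m + 1)} (h : i.val = 2 * j + 1) :
    interleave u v x t i = t j := by
  rw [interleave, dif_pos (by omega)]
  congr 1
  ext
  simp only
  omega

theorem interleave_inj {V : Type*} {u v : V} {m : ℕ} {x x' : Fin m → V} {t t' : Fin (m + 1) → V}
    (h : interleave u v x t = interleave u v x' t') : x = x' ∧ t = t' := by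
  constructor
  · funext i
    have hval : ((2 * (i + 1 : ℕ) : ℕ) : ZMod (2 * m + 3)).val = 2 * (i + 1) :=
      ZMod.val_cast_of_lt (by omega)
    have := congrFun h ((2 * (i + 1 : ℕ) : ℕ) : ZMod (2 * m + 3))
    rw [interleave_even _ _ _ _ hval, interleave_even _ _ _ _ hval] at this
    simpa [pathVertex] using this
  · funext i
    have hval : ((2 * (i : ℕ) + 1 : ℕ) : ZMod (2 * m + 3)).val = 2 * i + 1 :=
      ZMod.val_cast_of_lt (by omega)
    have := congrFun h ((2 * (i : ℕ) + 1 : ℕ) : ZMod (2 * m + 3))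
    rwa [interleave_odd _ _ _ _ hval, interleave_odd _ _ _ _ hval] at this

theorem interleave_injective {V : Type*} {u v : V} {S T : Finset V} (hST : Disjoint S T)
    (huv : u ≠ v) (huS : u ∈ S) (hvS : v ∈ S) {m : ℕ} {x : Fin m → V} {t : Fin (m + 1) → V}
    (hx : Function.Injective x) (hxS : ∀ i, x i ∈ S) (hu : ∀ i, x i ≠ u) (hv : ∀ i, x i ≠ v)
    (ht : Function.Injective t) (htT : ∀ i, t i ∈ T) :
    Function.Injective (interleave u v x t) := by
  intro i j h
  have hi := ZMod.val_lt i
  have hj := ZMod.val_lt j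
  apply ZMod.val_injective
  unfold interleave at h
  split_ifs at h with h1 h2 h2
  · have := congrArg Fin.val (ht h)
    simp only at this
    omega
  · exact absurd h.symm (Finset.disjoint_iff_ne.mp hST _ (pathVertex_mem huS hvS hxS _) _ (htT _))
  · exact absurd h (Finset.disjoint_iff_ne.mp hST _ (pathVertex_mem huS hvS hxS _) _ (htT _))
  · have := pathVertex_injOn huv hx hu hv (by omega) (by omega) h
    omega

theorem interleave_neg_one {V : Type*} (u v : V) {m : ℕ} (x : Fin m → V) (t : Fin (m + 1) → V) :
    interleave u v x t (-1) = u := by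
  have hval : (-1 : ZMod (2 * m + 3)).val = 2 * (m + 1) := ZMod.val_neg_one (2 * m + 2)
  rw [interleave_even _ _ _ _ hval]
  simp [pathVertex]

theorem interleave_zero {V : Type*} (u v : V) {m : ℕ} (x : Fin m → V) (t : Fin (m + 1) → V) :
    interleave u v x t 0 = v := by
  rw [interleave_even (j := 0) _ _ _ _ (by simp)]
  simp [pathVertex]

theorem interleave_adj {V : Type*} {G : SimpleGraph V} {u v : V} (huv : G.Adj u v) {m : ℕ}
    {x : Fin m → V} {t : Fin (m + 1) → V}
    (ht : ∀ i : Fin (m + 1), G.Adj (pathVertex u v x i) (t i) ∧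
      G.Adj (pathVertex u v x (i + 1)) (t i)) (i : ZMod (2 * m + 3)) :
    G.Adj (interleave u v x t i) (interleave u v x t (i + 1)) := by
  have hi := ZMod.val_lt i
  by_cases hlast : i = -1
  · rw [hlast, interleave_neg_one, neg_add_cancel, interleave_zero]
    exact huv
  · have hne : i.val ≠ 2 * m + 2 := fun h => hlast <| ZMod.val_injective _ <|
      h.trans (ZMod.val_neg_one (2 * m + 2)).symm
    have hone : (1 : ZMod (2 * m + 3)).val = 1 := ZMod.val_one'' (by omega)
    have hsucc : (i + 1).val = i.val + 1 := by
      rw [ZMod.val_add_of_lt (by omega), hone]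
    rcases Nat.even_or_odd' i.val with ⟨j, hj | hj⟩
    · rw [interleave_even _ _ _ _ hj,
        interleave_odd (j := ⟨j, by omega⟩) _ _ _ _ (by rw [hsucc, hj])]
      exact (ht ⟨j, by omega⟩).1
    · rw [interleave_odd (j := ⟨j, by omega⟩) _ _ _ _ hj,
        interleave_even (j := j + 1) _ _ _ _ (by omega)]
      exact (ht ⟨j, by omega⟩).2.symm

theorem stmt_5 {V : Type*} [Fintype V] (F : SimpleGraph V)
    (S T : Finset V) (hST : Disjoint S T) (s : ℕ)
    (hcommon : ∀ u ∈ S, ∀ v ∈ S, u ≠ v →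
      s ≤ (T.filter fun x => F.Adj u x ∧ F.Adj v x).card)
    (hedge : ∃ u ∈ S, ∃ v ∈ S, F.Adj u v)
    (l : ℕ) (hlodd : Odd l) (hl3 : 3 ≤ l)
    (hls : l ≤ 2 * s + 1) (hlS : l ≤ 2 * S.card - 1) :
    ((s : ℝ) - l / 2 + 3 / 2) ^ ((l - 1) / 2) *
        ((S.card : ℝ) - ((l : ℝ) - 1) / 2) ^ ((l - 3) / 2) ≤
      (cycleCount F l : ℝ) := by
  obtain ⟨u, huS, v, hvS, huv⟩ := hedge
  obtain ⟨m, rfl⟩ : ∃ m, l = 2 * m + 3 := by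
    obtain ⟨k, hk⟩ := hlodd
    exact ⟨k - 1, by omega⟩
  have hcardS : S.card - 2 ≤ ((S.erase u).erase v).card := by
    rw [Finset.card_erase_of_mem (Finset.mem_erase.mpr ⟨huv.ne', hvS⟩),
      Finset.card_erase_of_mem huS]
    omega
  obtain ⟨A, hA, hAcard⟩ := exists_distinct_representatives m (S.card - 2)
    (fun _ => (S.erase u).erase v) fun _ => hcardS
  simp only [Finset.mem_erase] at hA
  have hB (x : Fin m → V) : ∃ B : Finset (Fin (m + 1) → V), x ∈ A →
      (∀ t ∈ B, Function.Injective t ∧ ∀ i : Fin (m + 1),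
        t i ∈ T.filter fun y => F.Adj (pathVertex u v x i) y ∧ F.Adj (pathVertex u v x (i + 1)) y) ∧
      (s + 1 - (m + 1)) ^ (m + 1) ≤ B.card := by
    by_cases hx : x ∈ A
    · obtain ⟨hinj, hmem⟩ := hA x hx
      obtain ⟨B, hB⟩ := exists_distinct_representatives (m + 1) s
        (fun i : Fin (m + 1) => T.filter fun y =>
          F.Adj (pathVertex u v x i) y ∧ F.Adj (pathVertex u v x (i + 1)) y) fun i => by
        refine hcommon _ (pathVertex_mem huS hvS (fun i => (hmem i).2.2) _) _
          (pathVertex_mem huS hvS (fun i => (hmem i).2.2) _) fun h => ?_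
        have := pathVertex_injOn huv.ne hinj (fun i => (hmem i).2.1) (fun i => (hmem i).1)
          (by omega) (by omega) h
        omega
      exact ⟨B, fun _ => hB⟩
    · exact ⟨∅, fun h => absurd h hx⟩
  choose B hB using hB
  have hcount : (s + 1 - (m + 1)) ^ (m + 1) * (S.card - 2 + 1 - m) ^ m ≤
      cycleCount F (2 * m + 3) := by
    calc (s + 1 - (m + 1)) ^ (m + 1) * (S.card - 2 + 1 - m) ^ m
        ≤ (s + 1 - (m + 1)) ^ (m + 1) * A.card := Nat.mul_le_mul_left _ hAcard
      _ = ∑ _x ∈ A, (s + 1 - (m + 1)) ^ (m + 1) := by simp [mul_comm]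
      _ ≤ ∑ x ∈ A, (B x).card := Finset.sum_le_sum fun x hx => (hB x hx).2
      _ = ((A.sigma B).image fun q => interleave u v q.1 q.2).card := by
        rw [Finset.card_image_of_injective, Finset.card_sigma]
        rintro ⟨x, t⟩ ⟨x', t'⟩ h
        obtain ⟨rfl, rfl⟩ := interleave_inj h
        rfl
      _ ≤ cycleCount F (2 * m + 3) := by
        refine card_le_cycleCount F (by omega) u v _ fun p hp => ?_
        obtain ⟨⟨x, t⟩, hq, rfl⟩ := Finset.mem_image.mp hp
        obtain ⟨hx, ht⟩ := Finset.mem_sigma.mp hq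
        obtain ⟨hxinj, hxmem⟩ := hA x hx
        obtain ⟨htinj, htmem⟩ := (hB x hx).1 t ht
        simp only [Finset.mem_filter] at htmem
        exact ⟨interleave_injective hST huv.ne huS hvS hxinj (fun i => (hxmem i).2.2)
          (fun i => (hxmem i).2.1) (fun i => (hxmem i).1) htinj (fun i => (htmem i).1),
          interleave_adj huv fun i => (htmem i).2, interleave_zero .., interleave_neg_one ..⟩
  have hs : ((s + 1 - (m + 1) : ℕ) : ℝ) = (s : ℝ) - ((2 * m + 3 : ℕ) : ℝ) / 2 + 3 / 2 := by
    rw [Nat.cast_sub (by omega)]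
    push_cast
    ring
  have hS : ((S.card - 2 + 1 - m : ℕ) : ℝ) = (S.card : ℝ) - (((2 * m + 3 : ℕ) : ℝ) - 1) / 2 := by
    rw [show S.card - 2 + 1 - m = S.card - (m + 1) by omega, Nat.cast_sub (by omega)]
    push_cast
    ring
  rw [← hs, ← hS, show (2 * m + 3 - 1) / 2 = m + 1 by omega, show (2 * m + 3 - 3) / 2 = m by omega]
  exact_mod_cast hcount
end
end

section
/- Let S and T be two disjoint cliques in a graph F. Suppose there are two vertex-disjoint paths P_1 and P_2 in F such that each path has length at most 2, has one end vertex in S, the other end vertex in T, and all its remaining (interior) vertices outside S ∪ T. Then for any integer l with 7 ≤ l ≤ min(2|S|−1, 2|T|−1), the number of cycles of length l in F is at least (((l−1)/2 − 3)/e)^{l−6}. -/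
open Finset
open scoped Classical

noncomputable section

/-- A family of closed injective walks `ZMod l → V` which all start at the same vertex, continue
inside `S` and return from outside `S` consists of pairwise distinct cycles. -/
lemma card_le_cycleCount_of_injective {V ι : Type*} [Finite V] [Finite ι] {F : SimpleGraph V}
    {l : ℕ} [NeZero l] {S : Set V} {a : V} (f : ι → ZMod l → V) (hf : Function.Injective f)
    (hinj : ∀ i, Function.Injective (f i)) (hadj : ∀ i k, F.Adj (f i k) (f i (k + 1)))
    (hzero : ∀ i, f i 0 = a) (hone : ∀ i, f i 1 ∈ S) (hneg : ∀ i, f i (-1) ∉ S) :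
    Nat.card ι ≤ cycleCount F l := by
  unfold cycleCount
  rw [Nat.le_div_iff_mul_le (by have := NeZero.pos l; omega)]
  have hcard : Nat.card (ι × ℤˣ × ZMod l) = Nat.card ι * (2 * l) := by
    simp [Nat.card_prod, Nat.card_eq_fintype_card]
  rw [← hcard]
  have hsmul : ∀ (u : ℤˣ) (r k : ZMod l),
      ((u : ℤ) : ZMod l) * (((u : ℤ) : ZMod l) * k - ((u : ℤ) : ZMod l) * r) + r = k := by
    intro u r k
    rcases Int.units_eq_one_or u with rfl | rfl <;> simp
  refine Nat.card_le_card_of_injective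
    (fun x : ι × ℤˣ × ZMod l =>
      ⟨fun k => f x.1 (((x.2.1 : ℤ) : ZMod l) * k + x.2.2), ?_, ?_⟩) ?_
  · intro k k' h
    have h' := hinj _ h
    rcases Int.units_eq_one_or x.2.1 with hu | hu <;> simpa [hu] using h'
  · intro k
    rcases Int.units_eq_one_or x.2.1 with hu | hu
    · have := hadj x.1 (k + x.2.2)
      simpa [hu, add_right_comm] using this
    · have := (hadj x.1 (-(k + 1) + x.2.2)).symm
      have e : -(k + 1) + x.2.2 + 1 = -k + x.2.2 := by ring
      rw [e] at this
      simpa [hu] using this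
  · rintro ⟨i, u, r⟩ ⟨i', u', r'⟩ h
    simp only [Subtype.mk.injEq] at h
    have hk := fun k => congrFun h k
    have h0 : ((u' : ℤ) : ZMod l) * (-(((u : ℤ) : ZMod l) * r)) + r' = 0 := by
      have h1 := hk (-(((u : ℤ) : ZMod l) * r))
      have h2 := hsmul u r 0
      rw [mul_zero, zero_sub] at h2
      rw [h2, hzero] at h1
      exact hinj i' (by rw [← h1, hzero])
    have key : ∀ k, f i k = f i' (((u' : ℤ) : ZMod l) * (((u : ℤ) : ZMod l) * k)) := by
      intro k
      have h1 := hk (((u : ℤ) : ZMod l) * k - ((u : ℤ) : ZMod l) * r)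
      rw [hsmul] at h1
      rw [h1]
      congr 1
      linear_combination h0
    have huu : u = u' := by
      have h1 := key 1
      rcases Int.units_eq_one_or u with rfl | rfl <;>
        rcases Int.units_eq_one_or u' with rfl | rfl
      · rfl
      · exact absurd (by simpa [h1] using hone i) (hneg i')
      · exact absurd (by simpa [h1] using hone i) (hneg i')
      · rfl
    subst huu
    have hii : i = i' := hf <| funext fun k => by
      rw [key k]
      rcases Int.units_eq_one_or u with rfl | rfl <;> simp
    have hrr : r = r' := by
      have huu : ((u : ℤ) : ZMod l) * ((u : ℤ) : ZMod l) = 1 := by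
        rcases Int.units_eq_one_or u with rfl | rfl <;> simp
      linear_combination -h0 - r * huu
    rw [hii, hrr]

/-- The version of `card_le_cycleCount_of_injective` for cycles given as lists of vertices. -/
lemma card_le_cycleCount_of_lists {V ι : Type*} [Finite V] [Finite ι] {F : SimpleGraph V}
    {l : ℕ} {S : Set V} {a : V} (L : ι → List V) (hL : Function.Injective L)
    (hlen : ∀ i, (L i).length = l) (hnodup : ∀ i, (L i).Nodup)
    (hchain : ∀ i, (L i ++ [a]).IsChain F.Adj)
    (hends : ∀ i, ∃ y z M, L i = a :: y :: (M ++ [z]) ∧ y ∈ S ∧ z ∉ S) (hl : 3 ≤ l) :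
    Nat.card ι ≤ cycleCount F l := by
  have : NeZero l := ⟨by omega⟩
  have : Fact (1 < l) := ⟨by omega⟩
  have hlt : ∀ i (k : ZMod l), k.val < (L i).length := fun i k => by
    rw [hlen]; exact ZMod.val_lt k
  have hget0 : ∀ i, (L i)[0]'(by rw [hlen]; omega) = a := fun i => by
    obtain ⟨y, z, M, h, -⟩ := hends i
    simp [h]
  have hget1 : ∀ i, (L i)[1]'(by rw [hlen]; omega) ∈ S := fun i => by
    obtain ⟨y, z, M, h, hy, -⟩ := hends i
    simpa [h] using hy
  have hgetl : ∀ i, (L i)[l - 1]'(by rw [hlen]; omega) ∉ S := fun i => by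
    obtain ⟨y, z, M, h, -, hz⟩ := hends i
    have := hlen i
    simp only [h, List.length_cons, List.length_append, List.length_nil] at this
    have hl' : l - 1 = M.length + 2 := by omega
    simpa [h, hl'] using hz
  refine card_le_cycleCount_of_injective (S := S) (a := a)
    (fun i k => (L i)[k.val]'(hlt i k)) ?_ ?_ ?_ ?_ ?_ ?_
  · intro i j h
    refine hL (List.ext_getElem (by rw [hlen, hlen]) fun n h1 h2 => ?_)
    have := congrFun h (n : ZMod l)
    rw [hlen] at h1
    simpa [ZMod.val_natCast, Nat.mod_eq_of_lt h1] using this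
  · intro i k k' h
    exact ZMod.val_injective l ((hnodup i).getElem_inj_iff.1 h)
  · intro i k
    have hk := ZMod.val_lt k
    have h1 := List.isChain_iff_getElem.1 (hchain i) k.val (by simp [hlen]; omega)
    rw [List.getElem_append_left (hlt i k)] at h1
    have hv : (k + 1).val = (k.val + 1) % l := by
      rw [ZMod.val_add, ZMod.val_one]
    by_cases hkl : k.val + 1 < l
    · rw [Nat.mod_eq_of_lt hkl] at hv
      rw [List.getElem_append_left (by rw [hlen]; exact hkl)] at h1
      simpa [hv] using h1
    · have hkl' : k.val + 1 = l := by omega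
      rw [hkl', Nat.mod_self] at hv
      rw [List.getElem_append_right (by rw [hlen]; omega)] at h1
      simp only [List.getElem_singleton] at h1
      simpa [hv, hget0] using h1
  · intro i
    simpa using hget0 i
  · intro i
    simpa [ZMod.val_one] using hget1 i
  · intro i
    have hv : (-1 : ZMod l).val = l - 1 := by
      rw [ZMod.neg_val, if_neg one_ne_zero, ZMod.val_one]
    simpa [hv] using hgetl i

/-- The interior of a walk of length at most two with distinct ends. -/
lemma SimpleGraph.Walk.exists_interior_of_length_le_two {V : Type*} {F : SimpleGraph V} {a b : V}
    (p : F.Walk a b) (hab : a ≠ b) (hp : p.IsPath) (hlen : p.length ≤ 2) :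
    ∃ c : List V, c.length ≤ 1 ∧ (a :: (c ++ [b])).IsChain F.Adj ∧
      (∀ v ∈ c, v ∈ p.support ∧ v ≠ a ∧ v ≠ b) := by
  match p with
  | .nil => exact absurd rfl hab
  | .cons h .nil => exact ⟨[], by simp, by simp [h], by simp⟩
  | .cons (v := x) h (.cons h' .nil) =>
    exact ⟨[x], by simp, by simp [h, h'], by simp [h.ne', h'.ne]⟩
  | .cons h (.cons h' (.cons h'' q)) =>
    simp at hlen

/-- Vertices of a clique, listed without repetition, form a path. -/
lemma SimpleGraph.IsClique.isChain_of_nodup {V : Type*} {F : SimpleGraph V} {S : Set V}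
    (hS : F.IsClique S) {L : List V} (hL : L.Nodup) (hLS : ∀ v ∈ L, v ∈ S) :
    L.IsChain F.Adj := by
  refine List.Pairwise.isChain (hL.imp_of_mem fun ha hb hab => hS (hLS _ ha) (hLS _ hb) hab)

/-- Two disjoint cliques joined by two disjoint paths with interiors `c₁` and `c₂`: count the cycles
through both paths with `s + 2` vertices in `S` and `t + 2` vertices in `T`. -/
lemma descFactorial_mul_descFactorial_le_cycleCount {V : Type*} [Finite V] {F : SimpleGraph V}
    {S T : Finset V} (hST : Disjoint S T)
    (hS : F.IsClique (S : Set V)) (hT : F.IsClique (T : Set V))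
    {a₁ b₁ a₂ b₂ : V} (ha₁ : a₁ ∈ S) (ha₂ : a₂ ∈ S) (hb₁ : b₁ ∈ T) (hb₂ : b₂ ∈ T)
    (ha : a₁ ≠ a₂) (hb : b₁ ≠ b₂) {c₁ c₂ : List V}
    (hc₁ : (b₁ :: (c₁ ++ [a₁])).IsChain F.Adj) (hc₂ : (a₂ :: (c₂ ++ [b₂])).IsChain F.Adj)
    (hn₁ : c₁.Nodup) (hn₂ : c₂.Nodup) (hc : c₁.Disjoint c₂)
    (hout₁ : ∀ v ∈ c₁, v ∉ S ∧ v ∉ T) (hout₂ : ∀ v ∈ c₂, v ∉ S ∧ v ∉ T) (s t : ℕ) :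
    (S.card - 2).descFactorial s * (T.card - 2).descFactorial t ≤
      cycleCount F (s + t + 4 + c₁.length + c₂.length) := by
  set S' := (S.erase a₁).erase a₂ with hS'
  set T' := (T.erase b₁).erase b₂ with hT'
  have hcS : S'.card = S.card - 2 := by
    rw [hS', card_erase_of_mem (by simp [ha₂, ha.symm]), card_erase_of_mem ha₁]; rfl
  have hcT : T'.card = T.card - 2 := by
    rw [hT', card_erase_of_mem (by simp [hb₂, hb.symm]), card_erase_of_mem hb₁]; rfl
  have hcard : Nat.card ((Fin s ↪ S') × (Fin t ↪ T')) =
      (S.card - 2).descFactorial s * (T.card - 2).descFactorial t := by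
    simp [Nat.card_eq_fintype_card, Fintype.card_embedding_eq, hcS, hcT]
  rw [← hcard]
  let σ : (Fin s ↪ S') → List V := fun e => List.ofFn fun i => (e i : V)
  let τ : (Fin t ↪ T') → List V := fun e => List.ofFn fun i => (e i : V)
  have hσ : Function.Injective σ := fun e e' h => by
    have := List.ofFn_injective h
    ext i
    exact congrFun this i
  have hτ : Function.Injective τ := fun e e' h => by
    have := List.ofFn_injective h
    ext i
    exact congrFun this i
  have hσl : ∀ e, (σ e).length = s := fun e => by simp [σ]
  have hτl : ∀ e, (τ e).length = t := fun e => by simp [τ]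
  have hσn : ∀ e, (σ e).Nodup := fun e =>
    List.nodup_ofFn.2 (Subtype.val_injective.comp e.injective)
  have hτn : ∀ e, (τ e).Nodup := fun e =>
    List.nodup_ofFn.2 (Subtype.val_injective.comp e.injective)
  have hσm : ∀ e, ∀ v ∈ σ e, v ≠ a₂ ∧ v ≠ a₁ ∧ v ∈ S := fun e v hv => by
    obtain ⟨i, rfl⟩ := (List.mem_ofFn' _ _).1 hv
    simpa only [hS', mem_erase] using (e i).2
  have hτm : ∀ e, ∀ v ∈ τ e, v ≠ b₂ ∧ v ≠ b₁ ∧ v ∈ T := fun e v hv => by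
    obtain ⟨i, rfl⟩ := (List.mem_ofFn' _ _).1 hv
    simpa only [hT', mem_erase] using (e i).2
  have hdis : ∀ v, v ∈ S → v ∉ T := fun v h h' => Finset.disjoint_left.1 hST h h'
  clear_value σ τ
  have hσa : ∀ e, (a₁ :: (σ e ++ [a₂])).Nodup := fun e => by
    have := hσm e; have := hσn e
    simp only [List.nodup_cons, List.nodup_append, List.mem_append, List.mem_singleton]
    grind
  have hτb : ∀ e, (b₂ :: (τ e ++ [b₁])).Nodup := fun e => by
    have := hτm e; have := hτn e
    simp only [List.nodup_cons, List.nodup_append, List.mem_append, List.mem_singleton]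
    grind
  have hσS : ∀ e, ∀ v ∈ a₁ :: (σ e ++ [a₂]), v ∈ S := fun e v hv => by
    have := hσm e; grind
  have hτT : ∀ e, ∀ v ∈ b₂ :: (τ e ++ [b₁]), v ∈ T := fun e v hv => by
    have := hτm e; grind
  refine card_le_cycleCount_of_lists (S := S) (a := a₁)
    (fun e => (a₁ :: (σ e.1 ++ [a₂])) ++ (c₂ ++ ((b₂ :: (τ e.2 ++ [b₁])) ++ c₁)))
    ?_ ?_ ?_ ?_ ?_ (by omega)
  · rintro ⟨e, d⟩ ⟨e', d'⟩ h
    obtain ⟨h1, h2⟩ := List.append_inj h (by simp [hσl])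
    have h3 := (List.append_inj (List.append_cancel_left h2) (by simp [hτl])).1
    simp only [List.cons.injEq, true_and, List.append_cancel_right_eq] at h1 h3
    rw [hσ h1, hτ h3]
  · intro e
    simp [hσl, hτl]
    omega
  · rintro ⟨e, d⟩
    have h1 := hσa e; have h2 := hτb d; have h3 := hσS e; have h4 := hτT d
    dsimp only
    generalize a₁ :: (σ e ++ [a₂]) = A at *
    generalize b₂ :: (τ d ++ [b₁]) = B at *
    refine h1.append (hn₂.append (h2.append hn₁ ?_) ?_) ?_
    · intro v hv hv'; exact (hout₁ v hv').2 (h4 v hv)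
    · intro v hv hv'
      rcases List.mem_append.1 hv' with h | h
      · exact (hout₂ v hv).2 (h4 v h)
      · exact hc h hv
    · intro v hv hv'
      have := h3 v hv
      simp only [List.mem_append] at hv'
      rcases hv' with h | h | h
      · exact (hout₂ v h).1 this
      · exact hdis v this (h4 v h)
      · exact (hout₁ v h).1 this
  · rintro ⟨e, d⟩
    have h1 := hS.isChain_of_nodup (hσa e) (hσS e)
    have h2 := hT.isChain_of_nodup (hτb d) (hτT d)
    have h3 : ((a₁ :: σ e) ++ a₂ :: (c₂ ++ b₂ :: (τ d ++ b₁ :: (c₁ ++ [a₁])))).IsChain F.Adj := by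
      rw [List.isChain_split]
      refine ⟨by simpa using h1, ?_⟩
      have h4 : ((a₂ :: c₂) ++ b₂ :: (τ d ++ b₁ :: (c₁ ++ [a₁]))).IsChain F.Adj := by
        rw [List.isChain_split]
        refine ⟨by simpa using hc₂, ?_⟩
        have h5 : ((b₂ :: τ d) ++ b₁ :: (c₁ ++ [a₁])).IsChain F.Adj := by
          rw [List.isChain_split]
          exact ⟨by simpa using h2, hc₁⟩
        simpa using h5
      simpa using h4
    simpa using h3
  · rintro ⟨e, d⟩
    have hσ' : ∃ y N, σ e ++ [a₂] = y :: N ∧ y ∈ S := by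
      have := hσm e
      cases h : σ e with
      | nil => exact ⟨a₂, [], by simp, ha₂⟩
      | cons y N => exact ⟨y, N ++ [a₂], by simp, (this y (by simp [h])).2.2⟩
    have hlast : ∃ N z, [b₁] ++ c₁ = N ++ [z] ∧ z ∉ S := by
      rcases List.eq_nil_or_concat c₁ with rfl | ⟨N, z, rfl⟩
      · exact ⟨[], b₁, by simp, fun h => hdis _ h hb₁⟩
      · exact ⟨b₁ :: N, z, by simp, (hout₁ z (by simp)).1⟩
    obtain ⟨y, N, hy, hyS⟩ := hσ'
    obtain ⟨M, z, hz, hzS⟩ := hlast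
    refine ⟨y, z, N ++ c₂ ++ b₂ :: τ d ++ M, ?_, hyS, hzS⟩
    simp only [hy, List.cons_append, List.append_assoc, hz]

lemma factorial_le_two_mul_descFactorial {q k : ℕ} (hk : q ≤ k + 2) (hkq : k ≤ q) :
    q.factorial ≤ 2 * q.descFactorial k := by
  rw [← Nat.factorial_mul_descFactorial hkq]
  exact Nat.mul_le_mul_right _ (Nat.factorial_le (m := q - k) (n := 2) (by omega))

lemma pow_le_of_factorial_sq_le {l : ℕ} (hl : 7 ≤ l) {N : ℕ}
    (hN : ((l - 2) / 2).factorial ^ 2 ≤ 4 * N) :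
    ((((l : ℝ) - 1) / 2 - 3) / Real.exp 1) ^ (l - 6) ≤ (N : ℝ) := by
  obtain ⟨p, hp⟩ : ∃ p, (l - 2) / 2 = p + 2 := ⟨(l - 2) / 2 - 2, by omega⟩
  have hl7 : (7 : ℝ) ≤ l := by exact_mod_cast hl
  have hlp : (l : ℝ) ≤ 2 * p + 7 := by
    have : l ≤ 2 * p + 7 := by omega
    exact_mod_cast this
  have hp0 : (0 : ℝ) ≤ p := by positivity
  have hle : (((l : ℝ) - 1) / 2 - 3) / Real.exp 1 ≤ p / Real.exp 1 := by
    gcongr; linarith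
  refine (pow_le_pow_left₀ (by apply div_nonneg _ (Real.exp_pos _).le; linarith) hle _).trans ?_
  have hfac : ((p : ℝ) / Real.exp 1) ^ p ≤ p.factorial := by
    have h := Real.pow_div_factorial_le_exp (p : ℝ) hp0 p
    rw [div_pow, ← Real.exp_nat_mul, mul_one, div_le_iff₀ (Real.exp_pos _)]
    rwa [div_le_iff₀ (by positivity), mul_comm] at h
  have hx0 : 0 ≤ (p : ℝ) / Real.exp 1 := by positivity
  have hxp : (p : ℝ) / Real.exp 1 ≤ p + 1 := by
    have := div_le_self hp0 (Real.one_le_exp zero_le_one)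
    linarith
  have hpow : ((p : ℝ) / Real.exp 1) ^ (l - 6) ≤ (p.factorial : ℝ) ^ 2 * (p + 1) := by
    have h2 : (((p : ℝ) / Real.exp 1) ^ p) ^ 2 ≤ (p.factorial : ℝ) ^ 2 := by gcongr
    rcases (by omega : l - 6 = p * 2 ∨ l - 6 = p * 2 + 1) with h | h
    · rw [h, pow_mul]
      nlinarith [sq_nonneg (p.factorial : ℝ)]
    · rw [h, pow_succ, pow_mul]
      gcongr
  refine hpow.trans ?_
  rw [hp, Nat.factorial_succ, Nat.factorial_succ] at hN
  have hN' : (((p : ℝ) + 2) * ((p + 1) * p.factorial)) ^ 2 ≤ 4 * N := by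
    have : (((p + 1 + 1) * ((p + 1) * p.factorial) : ℕ) : ℝ) ^ 2 ≤ 4 * N := by exact_mod_cast hN
    push_cast at this
    convert this using 3
    ring
  have h4 : 4 * ((p.factorial : ℝ) ^ 2 * (p + 1)) ≤
      (((p : ℝ) + 2) * ((p + 1) * p.factorial)) ^ 2 := by
    have h5 : 4 * ((p : ℝ) + 1) ≤ ((p + 2) * (p + 1)) ^ 2 := by
      nlinarith [mul_nonneg hp0 hp0, mul_nonneg (mul_nonneg hp0 hp0) hp0,
        mul_nonneg (mul_nonneg hp0 hp0) (mul_nonneg hp0 hp0)]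
    calc 4 * ((p.factorial : ℝ) ^ 2 * (p + 1)) = (p.factorial : ℝ) ^ 2 * (4 * (p + 1)) := by ring
      _ ≤ (p.factorial : ℝ) ^ 2 * ((p + 2) * (p + 1)) ^ 2 := by gcongr
      _ = _ := by ring
  linarith

theorem stmt_6 {V : Type*} [Fintype V] (F : SimpleGraph V)
    (S T : Finset V) (hST : Disjoint S T)
    (hS : F.IsClique (S : Set V)) (hT : F.IsClique (T : Set V))
    (hpaths : ∃ (a₁ b₁ a₂ b₂ : V) (p₁ : F.Walk a₁ b₁) (p₂ : F.Walk a₂ b₂),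
      p₁.IsPath ∧ p₂.IsPath ∧ p₁.length ≤ 2 ∧ p₂.length ≤ 2 ∧
      a₁ ∈ S ∧ b₁ ∈ T ∧ a₂ ∈ S ∧ b₂ ∈ T ∧
      (∀ v ∈ p₁.support, v ≠ a₁ → v ≠ b₁ → v ∉ S ∧ v ∉ T) ∧
      (∀ v ∈ p₂.support, v ≠ a₂ → v ≠ b₂ → v ∉ S ∧ v ∉ T) ∧
      (∀ v ∈ p₁.support, v ∉ p₂.support))
    (l : ℕ) (hl7 : 7 ≤ l) (hlS : l ≤ 2 * S.card - 1) (hlT : l ≤ 2 * T.card - 1) :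
    ((((l : ℝ) - 1) / 2 - 3) / Real.exp 1) ^ (l - 6) ≤ (cycleCount F l : ℝ) := by
  obtain ⟨a₁, b₁, a₂, b₂, p₁, p₂, hp₁, hp₂, hlen₁, hlen₂, ha₁, hb₁, ha₂, hb₂, hi₁, hi₂, hdis⟩ :=
    hpaths
  have hab : ∀ {a b}, a ∈ S → b ∈ T → a ≠ b := fun ha hb h =>
    Finset.disjoint_left.1 hST ha (h ▸ hb)
  obtain ⟨c₁, hl₁, hc₁, hm₁⟩ := p₁.reverse.exists_interior_of_length_le_two
    (hab ha₁ hb₁).symm hp₁.reverse (by simpa using hlen₁)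
  obtain ⟨c₂, hl₂, hc₂, hm₂⟩ := p₂.exists_interior_of_length_le_two (hab ha₂ hb₂) hp₂ hlen₂
  simp only [SimpleGraph.Walk.support_reverse, List.mem_reverse] at hm₁
  have hnodup : ∀ {c : List V}, c.length ≤ 1 → c.Nodup := fun {c} h => by
    match c with
    | [] => simp
    | [x] => simp
    | x :: y :: c => simp at h
  have hcount := descFactorial_mul_descFactorial_le_cycleCount hST hS hT ha₁ ha₂ hb₁ hb₂
    (fun h => hdis a₁ p₁.start_mem_support (h ▸ p₂.start_mem_support))
    (fun h => hdis b₁ p₁.end_mem_support (h ▸ p₂.end_mem_support)) hc₁ hc₂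
    (hnodup hl₁) (hnodup hl₂) (fun v h h' => hdis v (hm₁ v h).1 (hm₂ v h').1)
    (fun v h => hi₁ v (hm₁ v h).1 (hm₁ v h).2.2 (hm₁ v h).2.1)
    (fun v h => hi₂ v (hm₂ v h).1 (hm₂ v h).2.1 (hm₂ v h).2.2)
    ((l - c₁.length - c₂.length) / 2 - 2)
    (l - c₁.length - c₂.length - (l - c₁.length - c₂.length) / 2 - 2)
  set s := (l - c₁.length - c₂.length) / 2 - 2 with hs
  set t := l - c₁.length - c₂.length - (l - c₁.length - c₂.length) / 2 - 2 with ht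
  rw [show s + t + 4 + c₁.length + c₂.length = l by omega] at hcount
  refine pow_le_of_factorial_sq_le hl7 (le_trans ?_ (Nat.mul_le_mul_left 4 hcount))
  have h1 := factorial_le_two_mul_descFactorial (q := (l - 2) / 2) (k := s) (by omega) (by omega)
  have h2 := factorial_le_two_mul_descFactorial (q := (l - 2) / 2) (k := t) (by omega) (by omega)
  have h3 := Nat.descFactorial_le s (show (l - 2) / 2 ≤ S.card - 2 by omega)
  have h4 := Nat.descFactorial_le t (show (l - 2) / 2 ≤ T.card - 2 by omega)
  calc ((l - 2) / 2).factorial ^ 2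
      ≤ (2 * (S.card - 2).descFactorial s) * (2 * (T.card - 2).descFactorial t) := by
        rw [sq]; exact Nat.mul_le_mul (by omega) (by omega)
    _ = 4 * ((S.card - 2).descFactorial s * (T.card - 2).descFactorial t) := by ring
end
end
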